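/- Jensen inequality for variance over Wasserstein barycenters in ℝⁿ: if Ω is a Borel probability measure on P(K) for a compact convex K ⊂ ℝⁿ and μ̄ is a W₂-barycenter of Ω, then Var(μ̄) ≤ ∫_{P(K)} Var(μ) dΩ(μ). -/

import Mathlib

open MeasureTheory Set Filter

/-- The variance of a measure on a metric space: the infimal second moment. -/
noncomputable def var {M : Type*} [MetricSpace M] [MeasurableSpace M] (mu : Measure M) : ℝ :=
  ⨅ y : M, ∫ x, dist x y ^ 2 ∂mu

/-- The squared 2-Wasserstein distance, as the infimal quadratic transport cost over couplings. -/
noncomputable def W2sq {M : Type*} [MetricSpace M] [MeasurableSpace M] (mu nu : Measure M) : ℝ :=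
  sInf ((fun gamma : Measure (M × M) => ∫ p, dist p.1 p.2 ^ 2 ∂gamma) ''
    {gamma | gamma.map Prod.fst = mu ∧ gamma.map Prod.snd = nu})

/-! ### Couplings and the transport cost on a compact metric space -/

section Coupling

lemma isProbabilityMeasure_of_map_fst {M : Type*} [MeasurableSpace M]
    {μ : ProbabilityMeasure M} {γ : Measure (M × M)}
    (h : γ.map Prod.fst = μ) : IsProbabilityMeasure γ := by
  refine ⟨?_⟩
  rw [← Set.preimage_univ (f := Prod.fst), ← Measure.map_apply measurable_fst MeasurableSet.univ, h]
  exact measure_univ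

lemma exists_sq_dist_le (M : Type*) [MetricSpace M] [CompactSpace M] :
    ∃ C : ℝ, ∀ x y : M, dist x y ^ 2 ≤ C :=
  ⟨Metric.diam (univ : Set M) ^ 2, fun x y => by
    gcongr
    exact Metric.dist_le_diam_of_mem isCompact_univ.isBounded (mem_univ x) (mem_univ y)⟩

lemma integral_sq_dist_le {M : Type*} [MetricSpace M] {X : Type*} [MeasurableSpace X]
    (μ : Measure X) [IsProbabilityMeasure μ] {f g : X → M} {C : ℝ} (hC : ∀ x y : M, dist x y ^ 2 ≤ C) :
    ∫ x, dist (f x) (g x) ^ 2 ∂μ ≤ C := by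
  calc ∫ x, dist (f x) (g x) ^ 2 ∂μ ≤ ∫ _, C ∂μ :=
        integral_mono_of_nonneg (ae_of_all _ fun _ => sq_nonneg _) (integrable_const C)
          (ae_of_all _ fun _ => hC _ _)
    _ = C := by simp

variable {M : Type*} [MetricSpace M] [MeasurableSpace M]

lemma W2sq_le_of_coupling {μ ν : Measure M} {γ : Measure (M × M)} (h₁ : γ.map Prod.fst = μ)
    (h₂ : γ.map Prod.snd = ν) : W2sq μ ν ≤ ∫ p, dist p.1 p.2 ^ 2 ∂γ := by
  refine csInf_le ⟨0, ?_⟩ ⟨γ, ⟨h₁, h₂⟩, rfl⟩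
  rintro _ ⟨γ, -, rfl⟩
  exact integral_nonneg fun p => sq_nonneg _

lemma le_W2sq (μ ν : ProbabilityMeasure M) {c : ℝ}
    (h : ∀ γ : Measure (M × M), γ.map Prod.fst = μ → γ.map Prod.snd = ν →
      c ≤ ∫ p, dist p.1 p.2 ^ 2 ∂γ) : c ≤ W2sq (μ : Measure M) (ν : Measure M) := by
  refine le_csInf ⟨_, (μ : Measure M).prod ν, ⟨by simp, by simp⟩, rfl⟩ ?_
  rintro _ ⟨γ, ⟨h₁, h₂⟩, rfl⟩
  exact h γ h₁ h₂

lemma W2sq_nonneg (μ ν : Measure M) : 0 ≤ W2sq μ ν := by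
  refine Real.sInf_nonneg ?_
  rintro _ ⟨γ, -, rfl⟩
  exact integral_nonneg fun p => sq_nonneg _

lemma bddBelow_integral_sq_dist (μ : Measure M) :
    BddBelow (range fun y : M => ∫ x, dist x y ^ 2 ∂μ) := by
  refine ⟨0, ?_⟩
  rintro _ ⟨y, rfl⟩
  exact integral_nonneg fun x => sq_nonneg _

lemma Continuous.integrable_of_compactSpace {X : Type*} [TopologicalSpace X] [CompactSpace X]
    [MeasurableSpace X] [OpensMeasurableSpace X] {E : Type*} [NormedAddCommGroup E]
    [SecondCountableTopologyEither X E]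
    {f : X → E} (hf : Continuous f) (μ : Measure X) [IsFiniteMeasure μ] : Integrable f μ := by
  obtain ⟨C, hC⟩ := isCompact_univ.exists_bound_of_continuousOn hf.continuousOn
  exact Integrable.of_bound hf.aestronglyMeasurable C (ae_of_all _ fun x => hC x (mem_univ x))

lemma ProbabilityMeasure.continuous_integral_of_continuous {X : Type*} [TopologicalSpace X]
    [CompactSpace X] [MeasurableSpace X] [OpensMeasurableSpace X] {f : X → ℝ} (hf : Continuous f) :
    Continuous fun μ : ProbabilityMeasure X => ∫ x, f x ∂(μ : Measure X) :=
  ProbabilityMeasure.continuous_integral_boundedContinuousFunction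
    (BoundedContinuousFunction.mkOfCompact ⟨f, hf⟩)

variable [CompactSpace M] [BorelSpace M]

/-- On a compact space an optimal coupling exists. -/
lemma exists_optimal_coupling (μ ν : ProbabilityMeasure M) :
    ∃ γ : ProbabilityMeasure (M × M), (γ : Measure (M × M)).map Prod.fst = μ ∧
      (γ : Measure (M × M)).map Prod.snd = ν ∧
      ∫ p, dist p.1 p.2 ^ 2 ∂(γ : Measure (M × M)) = W2sq (μ : Measure M) (ν : Measure M) := by
  let S : Set (ProbabilityMeasure (M × M)) :=
    {γ | γ.map continuous_fst.measurable.aemeasurable = μ ∧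
      γ.map continuous_snd.measurable.aemeasurable = ν}
  have hS : IsCompact S :=
    ((isClosed_eq (ProbabilityMeasure.continuous_map continuous_fst) continuous_const).inter
      (isClosed_eq (ProbabilityMeasure.continuous_map continuous_snd)
        continuous_const)).isCompact
  have hne : S.Nonempty := by
    refine ⟨μ.prod ν, Subtype.ext ?_, Subtype.ext ?_⟩
    · change ((μ : Measure M).prod (ν : Measure M)).map Prod.fst = μ
      simp
    · change ((μ : Measure M).prod (ν : Measure M)).map Prod.snd = ν
      simp
  have hc : Continuous fun p : M × M => dist p.1 p.2 ^ 2 := by fun_prop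
  obtain ⟨γ, ⟨h₁, h₂⟩, hmin⟩ := hS.exists_isMinOn hne
    (ProbabilityMeasure.continuous_integral_of_continuous hc).continuousOn
  have h₁' := congrArg Subtype.val h₁
  have h₂' := congrArg Subtype.val h₂
  refine ⟨γ, h₁', h₂', le_antisymm ?_ (W2sq_le_of_coupling h₁' h₂')⟩
  refine le_W2sq μ ν fun γ' g₁ g₂ => ?_
  have hp := isProbabilityMeasure_of_map_fst g₁
  exact hmin (a := (⟨γ', hp⟩ : ProbabilityMeasure (M × M))) ⟨Subtype.ext g₁, Subtype.ext g₂⟩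

/-- On a compact space the transport cost to a fixed measure is weakly lower semicontinuous. -/
lemma lowerSemicontinuous_W2sq (ν : ProbabilityMeasure M) :
    LowerSemicontinuous fun μ : ProbabilityMeasure M => W2sq (μ : Measure M) (ν : Measure M) := by
  rw [lowerSemicontinuous_iff_isClosed_preimage]
  intro c
  have hc : Continuous fun p : M × M => dist p.1 p.2 ^ 2 := by fun_prop
  let S : Set (ProbabilityMeasure (M × M)) :=
    {γ | γ.map continuous_snd.measurable.aemeasurable = ν ∧
      ∫ p, dist p.1 p.2 ^ 2 ∂(γ : Measure (M × M)) ≤ c}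
  have hS : IsCompact S :=
    ((isClosed_eq (ProbabilityMeasure.continuous_map continuous_snd) continuous_const).inter
      (isClosed_le (ProbabilityMeasure.continuous_integral_of_continuous hc)
        continuous_const)).isCompact
  convert (hS.image (ProbabilityMeasure.continuous_map continuous_fst)).isClosed using 1
  ext μ
  constructor
  · intro hμ
    obtain ⟨γ, h₁, h₂, h⟩ := exists_optimal_coupling μ ν
    exact ⟨γ, ⟨Subtype.ext h₂, h.le.trans hμ⟩, Subtype.ext h₁⟩
  · rintro ⟨γ, ⟨h₂, h⟩, rfl⟩
    exact (W2sq_le_of_coupling rfl (congrArg Subtype.val h₂)).trans h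

lemma integrable_W2sq [MeasurableSpace (ProbabilityMeasure M)] [BorelSpace (ProbabilityMeasure M)]
    (Ω : Measure (ProbabilityMeasure M)) [IsFiniteMeasure Ω] (ν : ProbabilityMeasure M) :
    Integrable (fun μ : ProbabilityMeasure M => W2sq (μ : Measure M) (ν : Measure M)) Ω := by
  obtain ⟨C, hC⟩ := exists_sq_dist_le M
  refine Integrable.of_bound (lowerSemicontinuous_W2sq ν).measurable.aestronglyMeasurable C
    (ae_of_all _ fun μ => ?_)
  rw [Real.norm_of_nonneg (W2sq_nonneg _ _)]
  obtain ⟨γ, -, -, h⟩ := exists_optimal_coupling μ ν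
  rw [← h]
  exact integral_sq_dist_le _ hC

lemma integrable_var [Nonempty M] [MeasurableSpace (ProbabilityMeasure M)]
    [BorelSpace (ProbabilityMeasure M)]
    (Ω : Measure (ProbabilityMeasure M)) [IsFiniteMeasure Ω] :
    Integrable (fun μ : ProbabilityMeasure M => var (μ : Measure M)) Ω := by
  obtain ⟨C, hC⟩ := exists_sq_dist_le M
  have husc : UpperSemicontinuous fun μ : ProbabilityMeasure M => var (μ : Measure M) :=
    upperSemicontinuous_ciInf (fun μ => bddBelow_integral_sq_dist _) fun y =>
      (ProbabilityMeasure.continuous_integral_of_continuous (by fun_prop)).upperSemicontinuous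
  refine Integrable.of_bound husc.measurable.aestronglyMeasurable C (ae_of_all _ fun μ => ?_)
  have h0 : 0 ≤ var (μ : Measure M) :=
    le_ciInf fun y => integral_nonneg fun x => sq_nonneg _
  rw [Real.norm_of_nonneg h0]
  obtain ⟨y⟩ := ‹Nonempty M›
  exact (ciInf_le (bddBelow_integral_sq_dist _) y).trans (integral_sq_dist_le _ hC)

end Coupling

/-! ### Euclidean identities and inequalities -/

section Euclidean

variable {E : Type*} [NormedAddCommGroup E] [InnerProductSpace ℝ E]

lemma dist_sq_lineMap (x y m : E) (t : ℝ) :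
    dist x (AffineMap.lineMap y m t) ^ 2 =
      (1 - t) * dist x y ^ 2 + t * dist x m ^ 2 - t * (1 - t) * dist y m ^ 2 := by
  have h1 : x - AffineMap.lineMap y m t = (x - m) - (1 - t) • (y - m) := by
    rw [AffineMap.lineMap_apply_module]; module
  have h2 : x - y = (x - m) - (y - m) := by abel
  rw [dist_eq_norm, dist_eq_norm, dist_eq_norm, dist_eq_norm, h1, h2,
    norm_sub_sq_real (x - m) ((1 - t) • (y - m)), norm_sub_sq_real (x - m) (y - m), norm_smul,
    inner_smul_right, mul_pow, Real.norm_eq_abs, sq_abs]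
  ring

lemma dist_sq_le_add_add_inner (x y m z : E) :
    dist x m ^ 2 ≤ dist x z ^ 2 + dist x y ^ 2 + 2 * inner ℝ (y - m) (z - m) := by
  have h : ∀ a b c : E, ‖a‖ ^ 2 ≤ ‖a - c‖ ^ 2 + ‖a - b‖ ^ 2 + 2 * inner ℝ b c := by
    intro a b c
    have h := sq_nonneg ‖a - (b + c)‖
    rw [norm_sub_sq_real, norm_add_sq_real, inner_add_right] at h
    rw [norm_sub_sq_real, norm_sub_sq_real]
    linarith
  have := h (x - m) (y - m) (z - m)
  simpa [dist_eq_norm] using this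

variable [MeasurableSpace E] [BorelSpace E] {K : Set E} [CompactSpace K]

/-- Contracting `ν` towards `m` changes the transport cost at most as along a generalized
geodesic ending at the Dirac mass at `m`. -/
lemma W2sq_map_contraction_le (μ ν : ProbabilityMeasure K) (m : K) {t : ℝ}
    {T : K → K} (hT : Continuous T)
    (hTt : ∀ y : K, (T y : E) = AffineMap.lineMap (y : E) (m : E) t) :
    W2sq (μ : Measure K) ((ν : Measure K).map T) ≤
      (1 - t) * W2sq (μ : Measure K) (ν : Measure K) + t * ∫ x, dist x m ^ 2 ∂(μ : Measure K)
        - t * (1 - t) * ∫ y, dist y m ^ 2 ∂(ν : Measure K) := by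
  obtain ⟨γ, h₁, h₂, h⟩ := exists_optimal_coupling μ ν
  have hTp : Continuous fun p : K × K => (p.1, T p.2) := by fun_prop
  have hd : Continuous fun p : K × K => dist p.1 p.2 ^ 2 := by fun_prop
  have hm : Continuous fun x : K => dist x m ^ 2 := by fun_prop
  have g₁ : ((γ : Measure (K × K)).map fun p => (p.1, T p.2)).map Prod.fst = μ := by
    rw [Measure.map_map measurable_fst hTp.measurable, ← h₁]; rfl
  have g₂ : ((γ : Measure (K × K)).map fun p => (p.1, T p.2)).map Prod.snd =
      (ν : Measure K).map T := by
    rw [Measure.map_map measurable_snd hTp.measurable, ← h₂,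
      Measure.map_map hT.measurable measurable_snd]; rfl
  refine (W2sq_le_of_coupling g₁ g₂).trans (le_of_eq ?_)
  rw [integral_map hTp.measurable.aemeasurable hd.aestronglyMeasurable, ← h]
  conv_rhs => rw [← h₁, ← h₂]
  rw [integral_map measurable_fst.aemeasurable hm.aestronglyMeasurable,
    integral_map measurable_snd.aemeasurable hm.aestronglyMeasurable]
  have i₀ := hd.integrable_of_compactSpace (γ : Measure (K × K))
  have i₁ := (hm.comp continuous_fst).integrable_of_compactSpace (γ : Measure (K × K))
  have i₂ := (hm.comp continuous_snd).integrable_of_compactSpace (γ : Measure (K × K))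
  simp only [Function.comp_def] at i₁ i₂
  have i₀₁ : Integrable (fun p : K × K => (1 - t) * dist p.1 p.2 ^ 2 + t * dist p.1 m ^ 2)
      (γ : Measure (K × K)) := (i₀.const_mul _).add (i₁.const_mul _)
  rw [← integral_const_mul, ← integral_const_mul, ← integral_const_mul,
    ← integral_add (i₀.const_mul _) (i₁.const_mul _), ← integral_sub i₀₁ (i₂.const_mul _)]
  refine integral_congr_ae (ae_of_all _ fun p => ?_)
  simp only [Subtype.dist_eq, hTt]
  exact dist_sq_lineMap _ _ _ _

/-- The second moment of `μ` about the mean of `ν` exceeds the variance of `μ` by at most the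
squared distance between the means, hence by at most the transport cost. -/
lemma integral_sq_dist_mean_le [CompleteSpace E] (μ ν : ProbabilityMeasure K) (m : K)
    (hm : (m : E) = ∫ y : K, (y : E) ∂(ν : Measure K)) :
    ∫ x, dist x m ^ 2 ∂(μ : Measure K) ≤
      W2sq (μ : Measure K) (ν : Measure K) + var (μ : Measure K) := by
  obtain ⟨γ, h₁, h₂, h⟩ := exists_optimal_coupling μ ν
  have : Nonempty K := ⟨m⟩
  rw [← sub_le_iff_le_add']
  refine le_ciInf fun z => ?_
  rw [sub_le_iff_le_add']
  have hd : Continuous fun p : K × K => dist p.1 p.2 ^ 2 := by fun_prop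
  have hc : ∀ w : K, Continuous fun x : K => dist x w ^ 2 := fun w => by fun_prop
  have hi : Continuous fun y : K => 2 * inner ℝ ((y : E) - m) ((z : E) - m) := by fun_prop
  have hzero : ∫ y : K, 2 * inner ℝ ((y : E) - m) ((z : E) - m) ∂(ν : Measure K) = 0 := by
    have iy : Integrable (fun y : K => (y : E)) (ν : Measure K) :=
      continuous_subtype_val.integrable_of_compactSpace _
    have iym : Integrable (fun y : K => (y : E) - m) (ν : Measure K) :=
      iy.sub (integrable_const _)
    rw [integral_const_mul]
    simp_rw [real_inner_comm ((z : E) - m)]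
    rw [integral_inner iym, integral_sub iy (integrable_const _), ← hm]
    simp
  have i₀ := hd.integrable_of_compactSpace (γ : Measure (K × K))
  have i₁ := fun w => ((hc w).comp continuous_fst).integrable_of_compactSpace (γ : Measure (K × K))
  have i₂ := (hi.comp continuous_snd).integrable_of_compactSpace (γ : Measure (K × K))
  simp only [Function.comp_def] at i₁ i₂
  have i₀₁ : Integrable (fun p : K × K => dist p.1 z ^ 2 + dist p.1 p.2 ^ 2)
      (γ : Measure (K × K)) := (i₁ z).add i₀
  have key := integral_mono (i₁ m) (i₀₁.add i₂)
    fun p => dist_sq_le_add_add_inner (p.1 : E) p.2 m z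
  simp only [Pi.add_apply] at key
  rw [integral_add i₀₁ i₂, integral_add (i₁ z) i₀, h] at key
  have e₁ : ∀ w : K, ∫ p : K × K, dist p.1 w ^ 2 ∂(γ : Measure (K × K)) =
      ∫ x, dist x w ^ 2 ∂(μ : Measure K) := fun w => by
    rw [← h₁, integral_map measurable_fst.aemeasurable (hc w).aestronglyMeasurable]
  have e₂ : ∫ p : K × K, 2 * inner ℝ ((p.2 : E) - m) ((z : E) - m) ∂(γ : Measure (K × K)) = 0 := by
    rw [← hzero, ← h₂, integral_map measurable_snd.aemeasurable hi.aestronglyMeasurable]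
  rw [e₁, e₁, e₂] at key
  linarith

end Euclidean

/-- Jensen's inequality for the variance over Wasserstein barycenters in ℝⁿ: for a compact
convex `K ⊂ ℝⁿ` and a probability measure `Ω` on `P(K)`, any `W₂`-barycenter `μ̄` of `Ω`
satisfies `Var(μ̄) ≤ ∫ Var(μ) dΩ(μ)`. -/
theorem variance_jensen_wasserstein_barycenter (n : ℕ) (K : Set (EuclideanSpace ℝ (Fin n)))
    (hKc : IsCompact K) (hKconv : Convex ℝ K) (hKne : K.Nonempty)
    [MeasurableSpace (ProbabilityMeasure K)] [BorelSpace (ProbabilityMeasure K)]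
    (Ω : Measure (ProbabilityMeasure K)) [IsProbabilityMeasure Ω]
    (μb : ProbabilityMeasure K)
    (hbc : ∀ ν : ProbabilityMeasure K,
      ∫ μ, W2sq (μ : Measure K) (μb : Measure K) ∂Ω ≤
      ∫ μ, W2sq (μ : Measure K) (ν : Measure K) ∂Ω) :
    var (μb : Measure K) ≤ ∫ μ, var (μ : Measure K) ∂Ω := by
  have : CompactSpace K := isCompact_iff_compactSpace.mp hKc
  have : Nonempty K := hKne.to_subtype
  obtain ⟨m, hm⟩ : ∃ m : K, (m : EuclideanSpace ℝ (Fin n)) =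
      ∫ y : K, (y : EuclideanSpace ℝ (Fin n)) ∂(μb : Measure K) :=
    ⟨⟨_, hKconv.integral_mem hKc.isClosed (ae_of_all _ fun y : K => y.2)
      (continuous_subtype_val.integrable_of_compactSpace (μb : Measure K))⟩, rfl⟩
  set W := ∫ μ, W2sq (μ : Measure K) (μb : Measure K) ∂Ω with hW
  set V := ∫ y, dist y m ^ 2 ∂(μb : Measure K)
  have iW := integrable_W2sq Ω μb
  have iV := integrable_var Ω
  have iA : Integrable (fun μ : ProbabilityMeasure K => ∫ x, dist x m ^ 2 ∂(μ : Measure K)) Ω :=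
    (ProbabilityMeasure.continuous_integral_of_continuous
      (by fun_prop)).integrable_of_compactSpace Ω
  set A := ∫ μ, (∫ x, dist x m ^ 2 ∂((μ : ProbabilityMeasure K) : Measure K)) ∂Ω with hA
  have hAW : A ≤ W + ∫ μ, var (μ : Measure K) ∂Ω := by
    rw [← integral_add iW iV]
    exact integral_mono iA (iW.add iV) fun μ => integral_sq_dist_mean_le μ μb m hm
  have hstep : ∀ t ∈ Ioo (0 : ℝ) 1, (1 - t) * V ≤ ∫ μ, var (μ : Measure K) ∂Ω := by
    intro t ht
    let T : K → K := fun y =>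
      ⟨AffineMap.lineMap (y : EuclideanSpace ℝ (Fin n)) (m : EuclideanSpace ℝ (Fin n)) t,
        hKconv.lineMap_mem y.2 m.2 ⟨ht.1.le, ht.2.le⟩⟩
    have hT : Continuous T := by
      refine Continuous.subtype_mk ?_ _
      simp only [AffineMap.lineMap_apply_module]
      fun_prop
    have hle : W ≤ (1 - t) * W + t * A - t * (1 - t) * V := by
      refine (hbc (μb.map hT.measurable.aemeasurable)).trans ?_
      have iWA : Integrable (fun μ : ProbabilityMeasure K =>
          (1 - t) * W2sq (μ : Measure K) (μb : Measure K) +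
            t * ∫ x, dist x m ^ 2 ∂(μ : Measure K)) Ω :=
        (iW.const_mul (1 - t)).add (iA.const_mul t)
      refine (integral_mono (integrable_W2sq Ω (μb.map hT.measurable.aemeasurable))
        (iWA.sub (integrable_const (t * (1 - t) * V)))
        fun μ => W2sq_map_contraction_le μ μb m hT fun _ => rfl).trans (le_of_eq ?_)
      simp only [Pi.sub_apply]
      rw [integral_sub iWA (integrable_const _),
        integral_add (iW.const_mul _) (iA.const_mul _), integral_const_mul, integral_const_mul]
      simp [hW, hA]
    have : t * (W + (1 - t) * V) ≤ t * A := by linarith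
    have := le_of_mul_le_mul_left this ht.1
    linarith
  have hV : V ≤ ∫ μ, var (μ : Measure K) ∂Ω := by
    have hlim : Tendsto (fun t : ℝ => (1 - t) * V) (nhdsWithin 0 (Ioi 0)) (nhds V) := by
      have : Continuous fun t : ℝ => (1 - t) * V := by fun_prop
      simpa using (this.tendsto 0).mono_left nhdsWithin_le_nhds
    exact le_of_tendsto hlim
      (mem_of_superset (Ioo_mem_nhdsGT one_pos) hstep)
  exact (ciInf_le (bddBelow_integral_sq_dist _) m).trans hV
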